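/- Let h ∈ ℝ^n with h ≥ 0. The pointwise Bellman inequality h^T x ≤ min_{u ∈ U(x)} [s^T x + r^T u + h^T(Ax + Bu)] holds for every x ∈ ℝ^n with x ≥ 0 if and only if the vector inequality h ≤ s + A^T h + Σ_{i=1}^n min{r_i + B_i^T h, 0} E_i (i.e., h ≤ T(h)) holds; this is exactly the consistency condition for the lower-bound heuristic and coincides with the constraint of the linear program in Theorem 1(iii). -/

import Mathlib

open Matrix Finset

/-- `minZero v` is the minimum of the entries of `v` and of the scalar `0`. -/
noncomputable def minZero {k : ℕ} (v : Fin k → ℝ) : ℝ :=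
  (insert (0 : ℝ) (Finset.image v Finset.univ)).min' (Finset.insert_nonempty _ _)

/-- The Bellman operator `T(p) = s + Aᵀ p + Σ_i min{r_i + B_iᵀ p, 0} E_i`. -/
noncomputable def bellman {n : ℕ} {m : Fin n → ℕ}
    (A : Matrix (Fin n) (Fin n) ℝ) (B : ∀ i, Matrix (Fin n) (Fin (m i)) ℝ)
    (s : Fin n → ℝ) (r : ∀ i, Fin (m i) → ℝ) (E : Matrix (Fin n) (Fin n) ℝ)
    (p : Fin n → ℝ) : Fin n → ℝ :=
  fun j => s j + (Aᵀ *ᵥ p) j +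
    ∑ i, minZero (fun l => r i l + ((B i)ᵀ *ᵥ p) l) * E i j

/-- Membership in the set 𝒦 of blockwise nonnegative feedback matrices with
full (`1ᵀ K_i = E_iᵀ`) or zero (`1ᵀ K_i = 0`) actuation in each block. -/
def memK {n : ℕ} {m : Fin n → ℕ} (E : Matrix (Fin n) (Fin n) ℝ)
    (K : ∀ i, Matrix (Fin (m i)) (Fin n) ℝ) : Prop :=
  ∀ i, (∀ l j, 0 ≤ K i l j) ∧
    ((∀ j, ∑ l, K i l j = E i j) ∨ (∀ j, ∑ l, K i l j = 0))

/-- Assumption 1: `(A + BK) x ≥ 0` for every `K ∈ 𝒦` and every `x ≥ 0`. -/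
def assumption1 {n : ℕ} {m : Fin n → ℕ}
    (A : Matrix (Fin n) (Fin n) ℝ) (B : ∀ i, Matrix (Fin n) (Fin (m i)) ℝ)
    (E : Matrix (Fin n) (Fin n) ℝ) : Prop :=
  ∀ K : ∀ i, Matrix (Fin (m i)) (Fin n) ℝ, memK E K →
    ∀ x : Fin n → ℝ, 0 ≤ x → 0 ≤ (A + ∑ i, B i * K i) *ᵥ x

/-- The constraint set `U(x) = {u : u ≥ 0, 1ᵀ u_i ≤ E_iᵀ x for all i}`. -/
def inputSet {n : ℕ} {m : Fin n → ℕ} (E : Matrix (Fin n) (Fin n) ℝ)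
    (x : Fin n → ℝ) : Set (∀ i, Fin (m i) → ℝ) :=
  {u | ∀ i, (∀ l, 0 ≤ u i l) ∧ (∑ l, u i l) ≤ ∑ j, E i j * x j}

/-- An admissible trajectory from `x0`: `x(0) = x0`, `u(t) ∈ U(x(t))` and
`x(t+1) = A x(t) + B u(t)`. -/
def admissible {n : ℕ} {m : Fin n → ℕ}
    (A : Matrix (Fin n) (Fin n) ℝ) (B : ∀ i, Matrix (Fin n) (Fin (m i)) ℝ)
    (E : Matrix (Fin n) (Fin n) ℝ) (x0 : Fin n → ℝ)
    (x : ℕ → Fin n → ℝ) (u : ℕ → ∀ i, Fin (m i) → ℝ) : Prop :=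
  x 0 = x0 ∧ ∀ t, u t ∈ inputSet E (x t) ∧
    x (t + 1) = A *ᵥ x t + ∑ i, (B i) *ᵥ (u t i)

/-- The state trajectory generated by a control sequence `u` from `x0`. -/
noncomputable def traj {n : ℕ} {m : Fin n → ℕ}
    (A : Matrix (Fin n) (Fin n) ℝ) (B : ∀ i, Matrix (Fin n) (Fin (m i)) ℝ)
    (x0 : Fin n → ℝ) (u : ℕ → ∀ i, Fin (m i) → ℝ) : ℕ → Fin n → ℝ
  | 0 => x0
  | t + 1 => A *ᵥ traj A B x0 u t + ∑ i, (B i) *ᵥ (u t i)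

/-- Total cost `Σ_{t=0}^∞ [sᵀ x(t) + rᵀ u(t)] ∈ [0,∞]` of a trajectory. -/
noncomputable def trajCost {n : ℕ} {m : Fin n → ℕ}
    (s : Fin n → ℝ) (r : ∀ i, Fin (m i) → ℝ)
    (x : ℕ → Fin n → ℝ) (u : ℕ → ∀ i, Fin (m i) → ℝ) : ENNReal :=
  ∑' t, ENNReal.ofReal ((∑ j, s j * x t j) + ∑ i, ∑ l, r i l * u t i l)

/-- Optimal value `V(x0)`: infimum of the total cost over admissible trajectories. -/
noncomputable def optValue {n : ℕ} {m : Fin n → ℕ}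
    (A : Matrix (Fin n) (Fin n) ℝ) (B : ∀ i, Matrix (Fin n) (Fin (m i)) ℝ)
    (E : Matrix (Fin n) (Fin n) ℝ) (s : Fin n → ℝ) (r : ∀ i, Fin (m i) → ℝ)
    (x0 : Fin n → ℝ) : ENNReal :=
  ⨅ (x : ℕ → Fin n → ℝ) (u : ℕ → ∀ i, Fin (m i) → ℝ)
    (_ : admissible A B E x0 x u), trajCost s r x u

/-- The spectral radius of `M` is strictly less than `1`. -/
def schurStable {n : ℕ} (M : Matrix (Fin n) (Fin n) ℝ) : Prop :=
  ∀ μ ∈ spectrum ℂ (M.map Complex.ofReal), ‖μ‖ < 1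

/-- `minZero v` is at most `0`. -/
theorem minZero_nonpos {k : ℕ} (v : Fin k → ℝ) : minZero v ≤ 0 :=
  Finset.min'_le _ _ (Finset.mem_insert_self _ _)

/-- `minZero v` is at most every entry of `v`. -/
theorem minZero_le {k : ℕ} (v : Fin k → ℝ) (l : Fin k) : minZero v ≤ v l :=
  Finset.min'_le _ _ (Finset.mem_insert_of_mem (Finset.mem_image_of_mem v (Finset.mem_univ l)))

/-- `minZero v` is either `0` or an entry of `v`. -/
theorem minZero_eq_zero_or_exists {k : ℕ} (v : Fin k → ℝ) :
    minZero v = 0 ∨ ∃ l, v l = minZero v := by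
  simpa [minZero] using
    Finset.min'_mem (insert (0 : ℝ) (Finset.image v Finset.univ)) (Finset.insert_nonempty _ _)

/-- `minZero v * c` is a lower bound for `v ⬝ᵥ u` over `u ≥ 0` with `1ᵀ u ≤ c`. -/
theorem minZero_mul_le_dotProduct {k : ℕ} (v u : Fin k → ℝ) {c : ℝ}
    (hu : ∀ l, 0 ≤ u l) (hc : ∑ l, u l ≤ c) : minZero v * c ≤ v ⬝ᵥ u :=
  calc minZero v * c ≤ minZero v * ∑ l, u l :=
        mul_le_mul_of_nonpos_left hc (minZero_nonpos v)
    _ = ∑ l, minZero v * u l := Finset.mul_sum _ _ _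
    _ ≤ v ⬝ᵥ u := Finset.sum_le_sum fun l _ =>
        mul_le_mul_of_nonneg_right (minZero_le v l) (hu l)

/-- The lower bound `minZero v * c` is attained. -/
theorem exists_dotProduct_eq_minZero_mul {k : ℕ} (v : Fin k → ℝ) {c : ℝ} (hc : 0 ≤ c) :
    ∃ u : Fin k → ℝ, (∀ l, 0 ≤ u l) ∧ ∑ l, u l ≤ c ∧ v ⬝ᵥ u = minZero v * c := by
  rcases minZero_eq_zero_or_exists v with h0 | ⟨l, hl⟩
  · exact ⟨0, fun _ => le_rfl, by simpa using hc, by simp [h0]⟩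
  · have hu : (0 : Fin k → ℝ) ≤ Pi.single l c := Pi.single_nonneg.mpr hc
    exact ⟨Pi.single l c, hu, by simp, by simp [hl]⟩

/-- The one-step cost-to-go separates into a state part and blockwise input parts. -/
theorem stage_cost_eq {n : ℕ} {m : Fin n → ℕ}
    (A : Matrix (Fin n) (Fin n) ℝ) (B : ∀ i, Matrix (Fin n) (Fin (m i)) ℝ)
    (s : Fin n → ℝ) (r : ∀ i, Fin (m i) → ℝ) (h x : Fin n → ℝ) (u : ∀ i, Fin (m i) → ℝ) :
    s ⬝ᵥ x + ∑ i, r i ⬝ᵥ u i + h ⬝ᵥ (A *ᵥ x + ∑ i, B i *ᵥ u i) =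
      (s + Aᵀ *ᵥ h) ⬝ᵥ x + ∑ i, (r i + (B i)ᵀ *ᵥ h) ⬝ᵥ u i := by
  simp only [mulVec_transpose, add_dotProduct, dotProduct_add, dotProduct_sum,
    dotProduct_mulVec, Finset.sum_add_distrib]
  ring

/-- The Bellman operator paired with a state. -/
theorem bellman_dotProduct {n : ℕ} {m : Fin n → ℕ}
    (A : Matrix (Fin n) (Fin n) ℝ) (B : ∀ i, Matrix (Fin n) (Fin (m i)) ℝ)
    (s : Fin n → ℝ) (r : ∀ i, Fin (m i) → ℝ) (E : Matrix (Fin n) (Fin n) ℝ)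
    (h x : Fin n → ℝ) :
    bellman A B s r E h ⬝ᵥ x =
      (s + Aᵀ *ᵥ h) ⬝ᵥ x + ∑ i, minZero (r i + (B i)ᵀ *ᵥ h) * (E i ⬝ᵥ x) := by
  have key : bellman A B s r E h =
      (s + Aᵀ *ᵥ h) + ∑ i, minZero (r i + (B i)ᵀ *ᵥ h) • E i := by
    ext j
    simp only [bellman, Pi.add_apply, Finset.sum_apply, Pi.smul_apply, smul_eq_mul]
    rfl
  simp only [key, add_dotProduct, sum_dotProduct, smul_dotProduct, smul_eq_mul]

/-- for `h ≥ 0`, the pointwise Bellman inequality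
`hᵀ x ≤ sᵀ x + rᵀ u + hᵀ(Ax + Bu)` for all `x ≥ 0` and `u ∈ U(x)` holds if and
only if the vector inequality `h ≤ T(h)` holds (consistency of the lower-bound
heuristic, i.e. the constraint of the LP in Theorem 1(iii)). -/
theorem stmt_13 {n : ℕ} {m : Fin n → ℕ}
    (A : Matrix (Fin n) (Fin n) ℝ) (B : ∀ i, Matrix (Fin n) (Fin (m i)) ℝ)
    (s : Fin n → ℝ) (r : ∀ i, Fin (m i) → ℝ) (E : Matrix (Fin n) (Fin n) ℝ)
    (hr : ∀ i l, 0 ≤ r i l) (hE : ∀ i j, 0 ≤ E i j)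
    (h : Fin n → ℝ) (hh : 0 ≤ h) :
    (∀ x : Fin n → ℝ, 0 ≤ x → ∀ u ∈ inputSet E x,
      (∑ j, h j * x j) ≤ (∑ j, s j * x j) + (∑ i, ∑ l, r i l * u i l) +
        ∑ j, h j * (A *ᵥ x + ∑ i, (B i) *ᵥ (u i)) j) ↔
    h ≤ bellman A B s r E h := by
  constructor
  · intro H j
    have hx : (0 : Fin n → ℝ) ≤ Pi.single j 1 := Pi.single_nonneg.mpr zero_le_one
    choose u hu hsum hval using fun i =>
      exists_dotProduct_eq_minZero_mul (r i + (B i)ᵀ *ᵥ h)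
        (dotProduct_nonneg_of_nonneg (hE i) hx)
    have hj := (H _ hx u fun i => ⟨hu i, hsum i⟩).trans_eq
      (stage_cost_eq A B s r h (Pi.single j 1) u)
    simp only [hval] at hj
    rw [← bellman_dotProduct] at hj
    change h ⬝ᵥ Pi.single j 1 ≤ _ at hj
    simpa using hj
  · intro H x hx u hu
    calc h ⬝ᵥ x ≤ bellman A B s r E h ⬝ᵥ x := dotProduct_le_dotProduct_of_nonneg_right H hx
      _ = _ := bellman_dotProduct A B s r E h x
      _ ≤ (s + Aᵀ *ᵥ h) ⬝ᵥ x + ∑ i, (r i + (B i)ᵀ *ᵥ h) ⬝ᵥ u i := by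
        gcongr with i
        exact minZero_mul_le_dotProduct _ _ (hu i).1 (hu i).2
      _ = _ := (stage_cost_eq A B s r h x u).symm
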